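/- For every integer m and every complex number u with Re(u) > 0, the integral ∫_{-∞}^{∞} (1+x²)^{-(1+u)/2} · ((1+ix)/√(1+x²))^{-m} dx converges absolutely and equals 2^{1-u} · π · Γ(u) / ( Γ((1+u+m)/2) · Γ((1+u-m)/2) ). -/

import Mathlib

open MeasureTheory

/-- The integrand of the degenerate Whittaker-type integral `𝒲_m(0,u)`. -/
noncomputable def whittakerIntegrand (m : ℤ) (u : ℂ) (x : ℝ) : ℂ :=
  (1 + (x : ℂ) ^ 2) ^ (-(1 + u) / 2) *
    ((1 + Complex.I * (x : ℂ)) / (Real.sqrt (1 + x ^ 2) : ℂ)) ^ (-(m : ℂ))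

/-- The Gamma quotient which is the value of the degenerate Whittaker-type integral. -/
noncomputable def whittakerValue (m : ℤ) (u : ℂ) : ℂ :=
  (2 : ℂ) ^ (1 - u) * (Real.pi : ℂ) * Complex.Gamma u /
    (Complex.Gamma ((1 + u + (m : ℂ)) / 2) * Complex.Gamma ((1 + u - (m : ℂ)) / 2))

theorem ofReal_sqrt_one_add_sq_ne_zero (x : ℝ) : (Real.sqrt (1 + x ^ 2) : ℂ) ≠ 0 :=
  Complex.ofReal_ne_zero.2 (Real.sqrt_pos.2 (by positivity)).ne'

theorem ofReal_sqrt_one_add_sq_sq (x : ℝ) :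
    (Real.sqrt (1 + x ^ 2) : ℂ) ^ 2 = 1 + (x : ℂ) ^ 2 := by
  rw [← Complex.ofReal_pow, Real.sq_sqrt (by positivity)]
  push_cast
  rfl

theorem ofReal_sqrt_one_add_sq_inv (x : ℝ) :
    (Real.sqrt (1 + x ^ 2) : ℂ)⁻¹ = (1 + (x : ℂ) ^ 2) ^ (-1 / 2 : ℂ) := by
  rw [Real.sqrt_eq_rpow, Complex.ofReal_cpow (by positivity), ← Complex.cpow_neg]
  push_cast
  congr 1
  ring

theorem one_add_sq_ofReal_ne_zero (x : ℝ) : (1 + (x : ℂ) ^ 2) ≠ 0 := by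
  rw [← ofReal_sqrt_one_add_sq_sq]
  exact pow_ne_zero _ (ofReal_sqrt_one_add_sq_ne_zero x)

theorem one_add_I_mul_ofReal_mul_sub (x : ℝ) :
    (1 + Complex.I * (x : ℂ)) * (1 - Complex.I * (x : ℂ)) = 1 + (x : ℂ) ^ 2 := by
  linear_combination -(x : ℂ) ^ 2 * Complex.I_sq

theorem one_add_I_mul_ofReal_ne_zero (x : ℝ) : (1 + Complex.I * (x : ℂ)) ≠ 0 :=
  left_ne_zero_of_mul (one_add_I_mul_ofReal_mul_sub x ▸ one_add_sq_ofReal_ne_zero x)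

theorem inv_one_add_I_mul_div_sqrt (x : ℝ) :
    ((1 + Complex.I * (x : ℂ)) / (Real.sqrt (1 + x ^ 2) : ℂ))⁻¹ =
      (1 - Complex.I * (x : ℂ)) / (Real.sqrt (1 + x ^ 2) : ℂ) := by
  rw [inv_div, div_eq_div_iff (one_add_I_mul_ofReal_ne_zero x)
    (ofReal_sqrt_one_add_sq_ne_zero x), ← pow_two, ofReal_sqrt_one_add_sq_sq,
    ← one_add_I_mul_ofReal_mul_sub]
  ring

theorem norm_one_add_I_mul_div_sqrt (x : ℝ) :
    ‖(1 + Complex.I * (x : ℂ)) / (Real.sqrt (1 + x ^ 2) : ℂ)‖ = 1 := by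
  have h : ‖1 + Complex.I * (x : ℂ)‖ = Real.sqrt (1 + x ^ 2) := by
    have := Complex.norm_add_mul_I 1 x
    rw [one_pow] at this
    rw [← this, mul_comm]
    simp
  rw [norm_div, h, Complex.norm_real, Real.norm_of_nonneg (Real.sqrt_nonneg _),
    div_self (Real.sqrt_pos.2 (by positivity)).ne']

theorem whittakerIntegrand_eq_zpow (m : ℤ) (u : ℂ) (x : ℝ) :
    whittakerIntegrand m u x = (1 + (x : ℂ) ^ 2) ^ (-(1 + u) / 2) *
      ((1 + Complex.I * (x : ℂ)) / (Real.sqrt (1 + x ^ 2) : ℂ)) ^ (-m) := by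
  rw [whittakerIntegrand, ← Complex.cpow_intCast, Int.cast_neg]

theorem norm_whittakerIntegrand (m : ℤ) (u : ℂ) (x : ℝ) :
    ‖whittakerIntegrand m u x‖ = (1 + ‖x‖ ^ 2) ^ (-(1 + u.re) / 2) := by
  have h : (1 + (x : ℂ) ^ 2) = ((1 + x ^ 2 : ℝ) : ℂ) := by push_cast; rfl
  rw [whittakerIntegrand_eq_zpow, norm_mul, norm_zpow, norm_one_add_I_mul_div_sqrt, one_zpow,
    mul_one, h, Complex.norm_cpow_eq_rpow_re_of_pos (by positivity), Real.norm_eq_abs, sq_abs]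
  congr 1
  simp

theorem continuous_whittakerIntegrand (m : ℤ) (u : ℂ) : Continuous (whittakerIntegrand m u) := by
  rw [funext (whittakerIntegrand_eq_zpow m u)]
  refine Continuous.mul ?_ ?_
  · refine Continuous.cpow (by fun_prop) continuous_const fun x => Or.inl ?_
    have h : (1 + (x : ℂ) ^ 2) = ((1 + x ^ 2 : ℝ) : ℂ) := by push_cast; rfl
    rw [h, Complex.ofReal_re]
    positivity
  · refine Continuous.zpow₀ ?_ _ fun x => Or.inl
      (div_ne_zero (one_add_I_mul_ofReal_ne_zero x) (ofReal_sqrt_one_add_sq_ne_zero x))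
    exact Continuous.div (by fun_prop) (by fun_prop) ofReal_sqrt_one_add_sq_ne_zero

theorem integrable_whittakerIntegrand (m : ℤ) {u : ℂ} (hu : 0 < u.re) :
    Integrable (whittakerIntegrand m u) := by
  have h := integrable_rpow_neg_one_add_norm_sq (E := ℝ) (μ := volume) (r := 1 + u.re)
    (by simpa using hu)
  exact h.mono' (continuous_whittakerIntegrand m u).aestronglyMeasurable
    (.of_forall fun x => (norm_whittakerIntegrand m u x).le)

theorem whittakerIntegrand_neg_left (m : ℤ) (u : ℂ) (x : ℝ) :
    whittakerIntegrand (-m) u x = whittakerIntegrand m u (-x) := by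
  have h := inv_one_add_I_mul_div_sqrt x
  rw [whittakerIntegrand_eq_zpow, whittakerIntegrand_eq_zpow, zpow_neg, ← inv_zpow, h]
  simp only [Complex.ofReal_neg, neg_sq, mul_neg, ← sub_eq_add_neg]

theorem integral_whittakerIntegrand_neg (m : ℤ) (u : ℂ) :
    ∫ x, whittakerIntegrand (-m) u x = ∫ x, whittakerIntegrand m u x := by
  simp only [whittakerIntegrand_neg_left]
  exact integral_neg_eq_self (whittakerIntegrand m u) volume

theorem whittakerIntegrand_add_one_add_sub_one (m : ℤ) (u : ℂ) (x : ℝ) :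
    whittakerIntegrand (m + 1) u x + whittakerIntegrand (m - 1) u x =
      2 * whittakerIntegrand m (u + 1) x := by
  have h0 := div_ne_zero (one_add_I_mul_ofReal_ne_zero x) (ofReal_sqrt_one_add_sq_ne_zero x)
  have hinv := inv_one_add_I_mul_div_sqrt x
  have hs := ofReal_sqrt_one_add_sq_inv x
  have hexp : -(1 + (u + 1)) / 2 = -(1 + u) / 2 + -1 / 2 := by ring
  simp only [whittakerIntegrand_eq_zpow]
  rw [hexp, Complex.cpow_add _ _ (one_add_sq_ofReal_ne_zero x), ← hs,
    show -(m + 1) = -m - 1 by ring, show -(m - 1) = -m + 1 by ring, zpow_sub_one₀ h0,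
    zpow_add_one₀ h0, hinv]
  ring

theorem integral_whittakerIntegrand_add_one_add_sub_one (m : ℤ) {u : ℂ} (hu : 0 < u.re) :
    (∫ x, whittakerIntegrand (m + 1) u x) + ∫ x, whittakerIntegrand (m - 1) u x =
      2 * ∫ x, whittakerIntegrand m (u + 1) x := by
  rw [← integral_add (integrable_whittakerIntegrand _ hu) (integrable_whittakerIntegrand _ hu),
    ← integral_const_mul]
  exact integral_congr_ae (.of_forall (whittakerIntegrand_add_one_add_sub_one m u))

theorem whittakerValue_neg (m : ℤ) (u : ℂ) : whittakerValue (-m) u = whittakerValue m u := by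
  simp only [whittakerValue, Int.cast_neg, sub_neg_eq_add, ← sub_eq_add_neg]
  rw [mul_comm (Complex.Gamma ((1 + u - m) / 2))]

theorem whittakerValue_add_one_add_sub_one (m : ℤ) {u : ℂ} (hu : u ≠ 0) :
    whittakerValue (m + 1) u + whittakerValue (m - 1) u = 2 * whittakerValue m (u + 1) := by
  have h1 := Complex.one_div_Gamma_eq_self_mul_one_div_Gamma_add_one ((u - m) / 2)
  have h2 := Complex.one_div_Gamma_eq_self_mul_one_div_Gamma_add_one ((u + m) / 2)
  have hpow : (2 : ℂ) ^ (1 - u) = 2 * 2 ^ (1 - (u + 1)) := by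
    rw [show (1 - u : ℂ) = 1 - (u + 1) + 1 by ring, Complex.cpow_add _ _ two_ne_zero,
      Complex.cpow_one, mul_comm]
  simp only [whittakerValue, Int.cast_add, Int.cast_sub, Int.cast_one, div_eq_mul_inv, mul_inv]
    at h1 h2 ⊢
  rw [Complex.Gamma_add_one u hu, hpow,
    show (1 + u - (m + 1)) * (2 : ℂ)⁻¹ = (u - m) * 2⁻¹ by ring,
    show (1 + u + (m - 1)) * (2 : ℂ)⁻¹ = (u + m) * 2⁻¹ by ring,
    show (1 + u + (m + 1)) * (2 : ℂ)⁻¹ = (u + m) * 2⁻¹ + 1 by ring,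
    show (1 + u - (m - 1)) * (2 : ℂ)⁻¹ = (u - m) * 2⁻¹ + 1 by ring,
    show (1 + (u + 1) + m) * (2 : ℂ)⁻¹ = (u + m) * 2⁻¹ + 1 by ring,
    show (1 + (u + 1) - m) * (2 : ℂ)⁻¹ = (u - m) * 2⁻¹ + 1 by ring, h1, h2]
  ring

theorem image_sq_div_one_add_sq_Ioi :
    (fun x : ℝ => x ^ 2 / (1 + x ^ 2)) '' Set.Ioi 0 = Set.Ioo 0 1 := by
  ext t
  constructor
  · rintro ⟨x, hx, rfl⟩
    have hx : 0 < x := hx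
    refine ⟨by positivity, ?_⟩
    rw [div_lt_one (by positivity)]
    linarith
  · rintro ⟨h0, h1⟩
    have h1 : 0 < 1 - t := sub_pos.2 h1
    refine ⟨Real.sqrt (t / (1 - t)), Real.sqrt_pos.2 (by positivity), ?_⟩
    simp only [Real.sq_sqrt (div_pos h0 h1).le]
    field_simp
    ring

theorem injOn_sq_div_one_add_sq_Ioi :
    Set.InjOn (fun x : ℝ => x ^ 2 / (1 + x ^ 2)) (Set.Ioi 0) := by
  intro x hx y hy h
  simp only at h
  rw [div_eq_div_iff (by positivity) (by positivity)] at h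
  exact (sq_eq_sq₀ (le_of_lt hx) (le_of_lt hy)).1 (by linarith)

theorem hasDerivAt_sq_div_one_add_sq (x : ℝ) :
    HasDerivAt (fun x : ℝ => x ^ 2 / (1 + x ^ 2)) (2 * x / (1 + x ^ 2) ^ 2) x := by
  have h := (hasDerivAt_pow 2 x).div ((hasDerivAt_pow 2 x).const_add 1)
    (by positivity : (1 + x ^ 2 : ℝ) ≠ 0)
  refine h.congr_deriv ?_
  simp
  ring

theorem integral_Ioi_one_add_sq_cpow (u : ℂ) :
    2 * ∫ x in Set.Ioi (0 : ℝ), (1 + (x : ℂ) ^ 2) ^ (-(1 + u) / 2) =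
      Complex.betaIntegral (1 / 2) (u / 2) := by
  rw [Complex.betaIntegral, intervalIntegral.integral_of_le zero_le_one,
    integral_Ioc_eq_integral_Ioo, ← image_sq_div_one_add_sq_Ioi,
    integral_image_eq_integral_abs_deriv_smul measurableSet_Ioi
      (fun x _ => (hasDerivAt_sq_div_one_add_sq x).hasDerivWithinAt)
      injOn_sq_div_one_add_sq_Ioi, ← integral_const_mul]
  refine setIntegral_congr_fun measurableSet_Ioi fun x hx => ?_
  have hx : 0 < x := hx
  have hp : 0 < 1 + x ^ 2 := by positivity
  set p := 1 + x ^ 2 with hpdef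
  have hpc : (p : ℂ) ≠ 0 := Complex.ofReal_ne_zero.2 hp.ne'
  have hxc : (x : ℂ) ≠ 0 := Complex.ofReal_ne_zero.2 hx.ne'
  have e1 : ((x ^ 2 / p : ℝ) : ℂ) ^ (1 / 2 - 1 : ℂ) = (p : ℂ) ^ (1 / 2 : ℂ) / x := by
    have hsq : ((x ^ 2 : ℝ) : ℂ) ^ (-(1 / 2) : ℂ) = (x : ℂ)⁻¹ := by
      rw [Complex.cpow_neg, show (1 / 2 : ℂ) = ((1 / 2 : ℝ) : ℂ) by push_cast; rfl,
        ← Complex.ofReal_cpow (by positivity), ← Real.sqrt_eq_rpow, Real.sqrt_sq hx.le]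
    rw [div_eq_mul_inv, Complex.ofReal_mul,
      Complex.mul_cpow_ofReal_nonneg (by positivity) (by positivity),
      show (1 / 2 - 1 : ℂ) = -(1 / 2) by ring, hsq, Complex.ofReal_inv, Complex.cpow_neg,
      Complex.inv_cpow _ _ (by simp [Complex.arg_ofReal_of_nonneg hp.le, Real.pi_pos.ne]),
      inv_inv]
    ring
  have e2 : (1 - ((x ^ 2 / p : ℝ) : ℂ)) ^ (u / 2 - 1) = (p : ℂ) ^ (1 - u / 2) := by
    have : (1 - ((x ^ 2 / p : ℝ) : ℂ)) = (p : ℂ)⁻¹ := by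
      rw [← Complex.ofReal_inv, ← Complex.ofReal_one, ← Complex.ofReal_sub]
      congr 1
      field_simp
      rw [hpdef]
      ring
    rw [this, Complex.inv_cpow _ _
      (by simp [Complex.arg_ofReal_of_nonneg hp.le, Real.pi_pos.ne]), ← Complex.cpow_neg, neg_sub]
  have e3 : (1 + (x : ℂ) ^ 2) = (p : ℂ) := by rw [hpdef]; push_cast; rfl
  have e4 : (p : ℂ) ^ (1 / 2 : ℂ) * (p : ℂ) ^ (1 - u / 2) =
      (p : ℂ) ^ (-(1 + u) / 2) * (p : ℂ) ^ 2 := by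
    rw [← Complex.cpow_add _ _ hpc, ← Complex.cpow_natCast, ← Complex.cpow_add _ _ hpc]
    congr 1
    push_cast
    ring
  rw [e1, e2, e3, abs_of_pos (by positivity), Complex.real_smul]
  push_cast
  generalize (p : ℂ) ^ (-(1 + u) / 2) = A at *
  generalize (p : ℂ) ^ (1 - u / 2) = B at *
  generalize (p : ℂ) ^ (1 / 2 : ℂ) = C at *
  field_simp
  linear_combination -e4

theorem integral_whittakerIntegrand_zero {u : ℂ} (hu : 0 < u.re) :
    ∫ x, whittakerIntegrand 0 u x = whittakerValue 0 u := by
  have hint := integrable_whittakerIntegrand 0 hu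
  have heven : ∫ x in Set.Iic (0 : ℝ), whittakerIntegrand 0 u x =
      ∫ x in Set.Ioi (0 : ℝ), whittakerIntegrand 0 u x := by
    have h := integral_comp_neg_Iic 0 (whittakerIntegrand 0 u)
    simp only [← whittakerIntegrand_neg_left, neg_zero] at h
    exact h
  have hbeta := integral_Ioi_one_add_sq_cpow u
  have hre : 0 < (u / 2).re := by simpa using hu
  have hre' : 0 < ((1 + u) / 2).re := by
    simp only [Complex.div_ofNat_re, Complex.add_re, Complex.one_re]
    positivity
  have hG := Complex.Gamma_ne_zero_of_re_pos hre'
  have hdup := Complex.Gamma_mul_Gamma_add_half (u / 2)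
  rw [show u / 2 + 1 / 2 = (1 + u) / 2 by ring, show 2 * (u / 2) = u by ring] at hdup
  have hpi : (Real.sqrt Real.pi : ℂ) ^ 2 = Real.pi := by
    rw [← Complex.ofReal_pow, Real.sq_sqrt Real.pi_pos.le]
  have hhalf : Complex.Gamma (1 / 2) = (Real.sqrt Real.pi : ℂ) := by
    rw [← Real.Gamma_one_half_eq, ← Complex.Gamma_ofReal]
    push_cast
    rfl
  rw [Complex.betaIntegral_eq_Gamma_mul_div _ _ (by norm_num) hre, ← add_div, hhalf] at hbeta
  have hzero : whittakerIntegrand 0 u = fun x : ℝ => (1 + (x : ℂ) ^ 2) ^ (-(1 + u) / 2) := by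
    ext x
    simp [whittakerIntegrand]
  rw [← intervalIntegral.integral_Iic_add_Ioi hint.integrableOn hint.integrableOn, heven,
    ← two_mul, hzero, hbeta, whittakerValue, Int.cast_zero, add_zero, sub_zero,
    div_eq_div_iff hG (mul_ne_zero hG hG), ← hpi]
  linear_combination
    (Real.sqrt Real.pi : ℂ) * Complex.Gamma ((1 + u) / 2) * hdup

theorem integral_whittakerIntegrand_natCast (n : ℕ) :
    ∀ {u : ℂ}, 0 < u.re → ∫ x, whittakerIntegrand n u x = whittakerValue n u := by
  induction n using Nat.strong_induction_on with
  | _ n ih =>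
    intro u hu
    have hu0 : u ≠ 0 := by rintro rfl; simp at hu
    have hu1 : 0 < (u + 1).re := by simp only [Complex.add_re, Complex.one_re]; positivity
    match n, ih with
    | 0, _ => simpa using integral_whittakerIntegrand_zero hu
    | 1, _ =>
      have hI := integral_whittakerIntegrand_add_one_add_sub_one 0 hu
      have hV := whittakerValue_add_one_add_sub_one 0 hu0
      rw [zero_add, zero_sub, integral_whittakerIntegrand_neg,
        integral_whittakerIntegrand_zero hu1] at hI
      rw [zero_add, zero_sub, whittakerValue_neg] at hV
      rw [Nat.cast_one]
      linear_combination (hI - hV) / 2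
    | n + 2, ih =>
      have hI := integral_whittakerIntegrand_add_one_add_sub_one (n + 1 : ℕ) hu
      have hV := whittakerValue_add_one_add_sub_one (n + 1 : ℕ) hu0
      rw [show ((n + 1 : ℕ) : ℤ) + 1 = (n + 2 : ℕ) by push_cast; ring,
        show ((n + 1 : ℕ) : ℤ) - 1 = n by push_cast; ring] at hI hV
      rw [ih n (by omega) hu, ih (n + 1) (by omega) hu1] at hI
      linear_combination hI - hV

theorem integral_whittakerIntegrand (m : ℤ) {u : ℂ} (hu : 0 < u.re) :
    ∫ x, whittakerIntegrand m u x = whittakerValue m u := by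
  obtain ⟨n, rfl | rfl⟩ := m.eq_nat_or_neg
  · exact integral_whittakerIntegrand_natCast n hu
  · rw [integral_whittakerIntegrand_neg, whittakerValue_neg]
    exact integral_whittakerIntegrand_natCast n hu

/-- The degenerate classical Whittaker-type integral `𝒲_m(0,u)`: for every integer `m` and
complex `u` with `Re u > 0`, the integral converges absolutely and evaluates in terms of
Gamma functions. -/
theorem stmt_0 (m : ℤ) (u : ℂ) (hu : 0 < u.re) :
    Integrable (fun x : ℝ =>
      (1 + (x : ℂ) ^ 2) ^ (-(1 + u) / 2) *
        ((1 + Complex.I * (x : ℂ)) / (Real.sqrt (1 + x ^ 2) : ℂ)) ^ (-(m : ℂ))) ∧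
    (∫ x : ℝ,
        (1 + (x : ℂ) ^ 2) ^ (-(1 + u) / 2) *
          ((1 + Complex.I * (x : ℂ)) / (Real.sqrt (1 + x ^ 2) : ℂ)) ^ (-(m : ℂ)))
      = (2 : ℂ) ^ (1 - u) * (Real.pi : ℂ) * Complex.Gamma u /
          (Complex.Gamma ((1 + u + (m : ℂ)) / 2) * Complex.Gamma ((1 + u - (m : ℂ)) / 2)) :=
  ⟨integrable_whittakerIntegrand m hu, integral_whittakerIntegrand m hu⟩
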